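/- The function H admits the closed-form expression: for all τ > 0, x, k ∈ ℝ and σ > 0, H(τ,x,k,σ) = e^{σ²τ + k − x} N(d₁) − φ(d₂)/(σ√τ) − d₂ φ(d₂)/(2σ²τ), where d₂ = (x−k)/(σ√τ) − σ√τ/2 and d₁ = d₂ − σ√τ. -/

import Mathlib

open Real MeasureTheory Set Filter

/-- Standard normal CDF `N(z) = (2π)^{-1/2} ∫_{-∞}^z e^{-t²/2} dt`. -/
noncomputable def Ncdf (z : ℝ) : ℝ :=
  (Real.sqrt (2 * Real.pi))⁻¹ * ∫ t in Set.Iic z, Real.exp (-t ^ 2 / 2)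

/-- Standard normal density `φ(z) = (2π)^{-1/2} e^{-z²/2}`. -/
noncomputable def phi (z : ℝ) : ℝ :=
  (Real.sqrt (2 * Real.pi))⁻¹ * Real.exp (-z ^ 2 / 2)

/-- `d₂ = (x-k)/(σ√τ) - σ√τ/2`. -/
noncomputable def d2 (τ x k σ : ℝ) : ℝ :=
  (x - k) / (σ * Real.sqrt τ) - σ * Real.sqrt τ / 2

/-- `d₁ = d₂ - σ√τ`. -/
noncomputable def d1 (τ x k σ : ℝ) : ℝ :=
  d2 τ x k σ - σ * Real.sqrt τ

/-- Black–Scholes price of an Inverse European call: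
`BS(τ,x,k,σ) = N(d₂) - e^{σ²τ + k - x} N(d₁)`. -/
noncomputable def BS (τ x k σ : ℝ) : ℝ :=
  Ncdf (d2 τ x k σ) - Real.exp (σ ^ 2 * τ + k - x) * Ncdf (d1 τ x k σ)

/-- Complementary error function `Erfc(z) = (2/√π) ∫_z^∞ e^{-t²} dt`. -/
noncomputable def Erfc (z : ℝ) : ℝ :=
  2 / Real.sqrt Real.pi * ∫ t in Set.Ioi z, Real.exp (-t ^ 2)

/-- `H(τ,x,k,σ) = ½ (∂³ₓₓₓ BS - ∂²ₓₓ BS)(τ,x,k,σ)`. -/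
noncomputable def Hfun (τ x k σ : ℝ) : ℝ :=
  (1 / 2) * (iteratedDeriv 3 (fun x' => BS τ x' k σ) x
    - iteratedDeriv 2 (fun x' => BS τ x' k σ) x)

/-- `G(τ,x,k,σ) = ∂ₖ H(τ,x,k,σ) - H(τ,x,k,σ)`. -/
noncomputable def Gfun (τ x k σ : ℝ) : ℝ :=
  deriv (fun k' => Hfun τ x k' σ) k - Hfun τ x k σ

theorem hasDerivAt_Ncdf (z : ℝ) : HasDerivAt Ncdf (phi z) z := by
  have hcont : Continuous fun t : ℝ => Real.exp (-t ^ 2 / 2) := by fun_prop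
  have hint : Integrable fun t : ℝ => Real.exp (-t ^ 2 / 2) := by
    convert integrable_exp_neg_mul_sq (b := 1 / 2) (by norm_num) using 3
    ring
  have hsplit : Ncdf = fun y => (Real.sqrt (2 * Real.pi))⁻¹ *
      ((∫ t in Set.Iic (0 : ℝ), Real.exp (-t ^ 2 / 2)) +
        ∫ t in (0 : ℝ)..y, Real.exp (-t ^ 2 / 2)) := by
    funext y
    rw [← intervalIntegral.integral_Iic_sub_Iic hint.integrableOn hint.integrableOn,
      add_sub_cancel, Ncdf]
  rw [hsplit]
  exact ((hcont.integral_hasStrictDerivAt 0 z).hasDerivAt.const_add _).const_mul _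

theorem hasDerivAt_phi (z : ℝ) : HasDerivAt phi (-z * phi z) z := by
  have h : HasDerivAt (fun t : ℝ => -t ^ 2 / 2) (-z) z := by
    refine ((hasDerivAt_pow 2 z).neg.div_const 2).congr_deriv ?_
    norm_num
    ring
  refine (h.exp.const_mul (Real.sqrt (2 * Real.pi))⁻¹).congr_deriv ?_
  rw [phi]
  ring

theorem hasDerivAt_d2 (τ x k σ : ℝ) :
    HasDerivAt (fun y => d2 τ y k σ) (σ * Real.sqrt τ)⁻¹ x := by
  simpa [d2] using (((hasDerivAt_id x).sub_const k).div_const (σ * Real.sqrt τ)).sub_const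
    (σ * Real.sqrt τ / 2)

theorem hasDerivAt_d1 (τ x k σ : ℝ) :
    HasDerivAt (fun y => d1 τ y k σ) (σ * Real.sqrt τ)⁻¹ x :=
  (hasDerivAt_d2 τ x k σ).sub_const _

theorem exp_mul_phi_d1 {τ σ : ℝ} (x k : ℝ) (hτ : 0 < τ) (hσ : 0 < σ) :
    Real.exp (σ ^ 2 * τ + k - x) * phi (d1 τ x k σ) = phi (d2 τ x k σ) := by
  have hs : σ * Real.sqrt τ ≠ 0 := (mul_pos hσ (Real.sqrt_pos.2 hτ)).ne'
  have hsq : σ ^ 2 * τ = (σ * Real.sqrt τ) ^ 2 := by rw [mul_pow, Real.sq_sqrt hτ.le]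
  rw [phi, phi, mul_left_comm, ← Real.exp_add, d1, d2, hsq]
  congr 2
  generalize σ * Real.sqrt τ = s at hs
  field_simp
  ring

theorem hasDerivAt_exp_mul_Ncdf_d1 {τ σ : ℝ} (x k : ℝ) (hτ : 0 < τ) (hσ : 0 < σ) :
    HasDerivAt (fun y => Real.exp (σ ^ 2 * τ + k - y) * Ncdf (d1 τ y k σ))
      (phi (d2 τ x k σ) / (σ * Real.sqrt τ)
        - Real.exp (σ ^ 2 * τ + k - x) * Ncdf (d1 τ x k σ)) x := by
  have h := ((hasDerivAt_id x).const_sub (σ ^ 2 * τ + k)).exp.mul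
    ((hasDerivAt_Ncdf _).comp x (hasDerivAt_d1 τ x k σ))
  refine h.congr_deriv ?_
  rw [← exp_mul_phi_d1 x k hτ hσ]
  simp only [id, Function.comp_apply]
  ring

theorem hasDerivAt_phi_d2 (τ x k σ : ℝ) :
    HasDerivAt (fun y => phi (d2 τ y k σ) / (σ * Real.sqrt τ))
      (-(d2 τ x k σ * phi (d2 τ x k σ) / (σ * Real.sqrt τ) ^ 2)) x := by
  refine (((hasDerivAt_phi _).comp x (hasDerivAt_d2 τ x k σ)).div_const _).congr_deriv ?_
  ring

theorem deriv_BS {τ σ : ℝ} (k : ℝ) (hτ : 0 < τ) (hσ : 0 < σ) :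
    deriv (fun y => BS τ y k σ)
      = fun y => Real.exp (σ ^ 2 * τ + k - y) * Ncdf (d1 τ y k σ) := by
  funext x
  refine ((((hasDerivAt_Ncdf _).comp x (hasDerivAt_d2 τ x k σ)).sub
    (hasDerivAt_exp_mul_Ncdf_d1 x k hτ hσ)).congr_deriv ?_).deriv
  ring

/-- closed form of the function `H`. -/
theorem stmt_5 (τ x k σ : ℝ) (hτ : 0 < τ) (hσ : 0 < σ) :
    Hfun τ x k σ
      = Real.exp (σ ^ 2 * τ + k - x) * Ncdf (d1 τ x k σ)
        - phi (d2 τ x k σ) / (σ * Real.sqrt τ)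
        - d2 τ x k σ * phi (d2 τ x k σ) / (2 * σ ^ 2 * τ) := by
  have h2 : iteratedDeriv 2 (fun y => BS τ y k σ)
      = fun y => phi (d2 τ y k σ) / (σ * Real.sqrt τ)
        - Real.exp (σ ^ 2 * τ + k - y) * Ncdf (d1 τ y k σ) := by
    rw [iteratedDeriv_succ, iteratedDeriv_one, deriv_BS k hτ hσ]
    funext y
    exact (hasDerivAt_exp_mul_Ncdf_d1 y k hτ hσ).deriv
  have h3 : iteratedDeriv 3 (fun y => BS τ y k σ) x
      = -(d2 τ x k σ * phi (d2 τ x k σ) / (σ * Real.sqrt τ) ^ 2)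
        - (phi (d2 τ x k σ) / (σ * Real.sqrt τ)
          - Real.exp (σ ^ 2 * τ + k - x) * Ncdf (d1 τ x k σ)) := by
    rw [iteratedDeriv_succ, h2]
    exact ((hasDerivAt_phi_d2 τ x k σ).sub (hasDerivAt_exp_mul_Ncdf_d1 x k hτ hσ)).deriv
  have hsq : 2 * σ ^ 2 * τ = 2 * (σ * Real.sqrt τ) ^ 2 := by
    rw [mul_pow, Real.sq_sqrt hτ.le, mul_assoc]
  rw [Hfun, h3, h2, hsq]
  ring
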